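/- arXiv:math/0411026 — 2 statements merged into one kernel-verified Lean document; each statement's English description precedes it below -/
import Mathlib

section
/- Let r' and r'' be rationals with 0 ≤ r' ≤ r'' < 1, let ω be a weight map, and let A' and A'' be antichains in P with A' ≤ A'' in 𝔄_▽(P). Then y_{r''}(A'') ≤ y_{r'}(A'') ≤ y_{r'}(A') in 𝔄_▽(P), that is, 𝔉(y_{r''}(A'')) ⊆ 𝔉(y_{r'}(A'')) ⊆ 𝔉(y_{r'}(A')). -/
open scoped Classical

variable {α : Type*}

/-- The order ideal generated by a subset `S` of a poset. -/
def idl [PartialOrder α] (S : Set α) : Set α := {p | ∃ s ∈ S, p ≤ s}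

/-- The order filter generated by a subset `S` of a poset. -/
def filt [PartialOrder α] (S : Set α) : Set α := {p | ∃ s ∈ S, s ≤ p}

/-- The set of maximal elements of a subposet. -/
def maxOf [PartialOrder α] (S : Set α) : Set α := {x | x ∈ S ∧ ∀ y ∈ S, x ≤ y → x = y}

/-- The set of minimal elements of a subposet. -/
def minOf [PartialOrder α] (S : Set α) : Set α := {x | x ∈ S ∧ ∀ y ∈ S, y ≤ x → x = y}

/-- The meet `A ∧_▵ B := max (𝔍(A) ∩ 𝔍(B))` of antichains in `𝔄_▵(P)`. -/
def meetT [PartialOrder α] (A B : Set α) : Set α := maxOf (idl A ∩ idl B)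

/-- A weight map `ω` on antichains of `P`: `ω(∅) = -1`, `ω({⊥}) = 0`, and
`0 < ω(A') ≤ ω(A'')` whenever `{⊥} < A' ≤ A''` in `𝔄_▵(P)`. -/
structure WeightMap (α : Type*) [PartialOrder α] [OrderBot α] where
  w : Set α → ℤ
  w_empty : w (∅ : Set α) = -1
  w_bot : w ({⊥} : Set α) = 0
  w_pos_mono : ∀ A' A'' : Set α, IsAntichain (· ≤ ·) A' → IsAntichain (· ≤ ·) A'' →
    idl ({⊥} : Set α) ⊂ idl A' → idl A' ⊆ idl A'' → 0 < w A' ∧ w A' ≤ w A''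

/-- The subposet `I_r(P,A;ω)` of relatively `r`-blocking elements for `A` in `P`. -/
noncomputable def relBlock [PartialOrder α] [OrderBot α] (ω : WeightMap α) (r : ℚ)
    (A : Set α) : Set α :=
  if A = ∅ then Set.univ
  else if A = ({⊥} : Set α) then ∅
  else {b | b ≠ ⊥ ∧ ∀ a ∈ A \ {⊥}, r < (ω.w (meetT {b} {a}) : ℚ) / (ω.w {b} : ℚ)}

/-- The relative `r`-blocker map `y_r` on antichains: a nontrivial antichain is sent to
`min I_r(P,A;ω)`, and `∅ ↦ {⊥}`, `{⊥} ↦ ∅`. -/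
noncomputable def yr [PartialOrder α] [OrderBot α] (ω : WeightMap α) (r : ℚ)
    (A : Set α) : Set α :=
  if A = ∅ then ({⊥} : Set α)
  else if A = ({⊥} : Set α) then ∅
  else minOf (relBlock ω r A)

theorem filt_minOf_mono [Finite α] [PartialOrder α] {S T : Set α} (h : S ⊆ T) :
    filt (minOf S) ⊆ filt (minOf T) := by
  rintro p ⟨s, hs, hsp⟩
  obtain ⟨m, hms, hm⟩ := T.toFinite.exists_le_minimal (h hs.1)
  exact ⟨m, ⟨hm.prop, fun y hy hym => hm.eq_of_ge hy hym⟩, hms.trans hsp⟩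

theorem isAntichain_maxOf [PartialOrder α] (S : Set α) : IsAntichain (· ≤ ·) (maxOf S) :=
  fun _ hx _ hy hne hle => hne (hx.2 _ hy.1 hle)

theorem idl_meetT [Finite α] [PartialOrder α] (A B : Set α) :
    idl (meetT A B) = idl A ∩ idl B := by
  ext p
  constructor
  · rintro ⟨s, ⟨⟨⟨a, ha, hsa⟩, ⟨b, hb, hsb⟩⟩, -⟩, hps⟩
    exact ⟨⟨a, ha, hps.trans hsa⟩, ⟨b, hb, hps.trans hsb⟩⟩
  · intro hp
    obtain ⟨m, hpm, hm⟩ := (idl A ∩ idl B).toFinite.exists_le_maximal hp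
    exact ⟨m, ⟨hm.prop, fun y hy hmy => hm.eq_of_le hy hmy⟩, hpm⟩

theorem WeightMap.w_singleton_pos [PartialOrder α] [OrderBot α] (ω : WeightMap α) {b : α}
    (hb : b ≠ ⊥) : 0 < ω.w {b} := by
  refine (ω.w_pos_mono {b} {b} (IsAntichain.singleton) (IsAntichain.singleton)
    ⟨?_, fun h => ?_⟩ subset_rfl).1
  · rintro p ⟨s, rfl, hp⟩
    exact ⟨b, rfl, hp.trans bot_le⟩
  · obtain ⟨s, rfl, hs⟩ := h ⟨b, rfl, le_rfl⟩
    exact hb (le_bot_iff.1 hs)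

/-- A meet of positive weight has no larger weight than the meet with a larger element. -/
theorem WeightMap.w_meetT_le [Finite α] [PartialOrder α] [OrderBot α] (ω : WeightMap α)
    {a c b : α} (hac : a ≤ c) (hpos : 0 < ω.w (meetT {b} {a})) :
    ω.w (meetT {b} {a}) ≤ ω.w (meetT {b} {c}) := by
  refine (ω.w_pos_mono _ _ (isAntichain_maxOf _) (isAntichain_maxOf _) ⟨?_, fun h => ?_⟩ ?_).2
  · rw [← meetT, idl_meetT]
    rintro p ⟨s, rfl, hp⟩
    exact ⟨⟨b, rfl, hp.trans bot_le⟩, ⟨a, rfl, hp.trans bot_le⟩⟩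
  · have hsub : ∀ x ∈ meetT {b} {a}, x = ⊥ := by
      intro x hx
      obtain ⟨s, rfl, hs⟩ := h ⟨x, hx, le_rfl⟩
      exact le_bot_iff.1 hs
    rcases Set.subset_singleton_iff_eq.1 (Set.subset_singleton_iff.2 hsub) with h0 | h0
    · rw [h0, ω.w_empty] at hpos
      omega
    · rw [h0, ω.w_bot] at hpos
      omega
  · rw [← meetT, ← meetT, idl_meetT, idl_meetT]
    rintro p ⟨hpb, s, rfl, hp⟩
    exact ⟨hpb, c, rfl, hp.trans hac⟩

theorem relBlock_anti [PartialOrder α] [OrderBot α] (ω : WeightMap α) {r s : ℚ} (h : r ≤ s)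
    (A : Set α) : relBlock ω s A ⊆ relBlock ω r A := by
  unfold relBlock
  split_ifs
  · exact subset_rfl
  · exact subset_rfl
  · exact fun b hb => ⟨hb.1, fun a ha => h.trans_lt (hb.2 a ha)⟩

theorem IsAntichain.eq_singleton_bot [PartialOrder α] [OrderBot α] {A : Set α}
    (hA : IsAntichain (· ≤ ·) A) (h : ⊥ ∈ A) : A = {⊥} :=
  Set.eq_singleton_iff_unique_mem.2 ⟨h, fun _ hx => (hA.eq h hx bot_le).symm⟩

theorem relBlock_subset_of_filt_subset [Finite α] [PartialOrder α] [OrderBot α]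
    (ω : WeightMap α) {r : ℚ} (hr : 0 ≤ r) {A B : Set α} (hB : IsAntichain (· ≤ ·) B)
    (hA0 : A ≠ ∅) (hA1 : A ≠ {⊥}) (hB0 : B ≠ ∅) (hB1 : B ≠ {⊥}) (hle : filt A ⊆ filt B) :
    relBlock ω r B ⊆ relBlock ω r A := by
  rw [relBlock, if_neg hB0, if_neg hB1, relBlock, if_neg hA0, if_neg hA1]
  rintro b ⟨hb, hbB⟩
  refine ⟨hb, fun a ha => ?_⟩
  obtain ⟨c, hc, hca⟩ := hle ⟨a, ha.1, le_rfl⟩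
  have hcb : c ≠ ⊥ := by
    rintro rfl
    exact hB1 (hB.eq_singleton_bot hc)
  have hlt := hbB c ⟨hc, hcb⟩
  have hw : (0 : ℚ) < ω.w {b} := by exact_mod_cast ω.w_singleton_pos hb
  have hpos : 0 < ω.w (meetT {b} {c}) := by
    exact_mod_cast (div_pos_iff_of_pos_right hw).1 (hr.trans_lt hlt)
  refine hlt.trans_le (div_le_div_of_nonneg_right ?_ hw.le)
  exact_mod_cast ω.w_meetT_le hca hpos

/-- If `0 ≤ r' ≤ r'' < 1` and `A' ≤ A''` in `𝔄_▽(P)`, then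
`y_{r''}(A'') ≤ y_{r'}(A'') ≤ y_{r'}(A')` in `𝔄_▽(P)`. -/
theorem stmt_3 [Fintype α] [PartialOrder α] [BoundedOrder α] [Nontrivial α]
    (ω : WeightMap α) (r' r'' : ℚ) (hr0 : 0 ≤ r') (hr : r' ≤ r'') (hr1 : r'' < 1)
    (A' A'' : Set α) (hA' : IsAntichain (· ≤ ·) A') (hA'' : IsAntichain (· ≤ ·) A'')
    (hle : filt A' ⊆ filt A'') :
    filt (yr ω r'' A'') ⊆ filt (yr ω r' A'') ∧
      filt (yr ω r' A'') ⊆ filt (yr ω r' A') := by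
  constructor
  · unfold yr
    split_ifs
    · exact subset_rfl
    · exact subset_rfl
    · exact filt_minOf_mono (relBlock_anti ω hr A'')
  · by_cases hA0 : A' = ∅
    · intro p _
      rw [yr, if_pos hA0]
      exact ⟨⊥, rfl, bot_le⟩
    obtain ⟨a, ha⟩ := Set.nonempty_iff_ne_empty.2 hA0
    have hB0 : A'' ≠ ∅ := by
      obtain ⟨c, hc, -⟩ := hle ⟨a, ha, le_rfl⟩
      exact Set.nonempty_iff_ne_empty.1 ⟨c, hc⟩
    by_cases hB1 : A'' = {⊥}
    · rw [yr, if_neg hB0, if_pos hB1]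
      rintro p ⟨s, hs, -⟩
      exact hs.elim
    have hA1 : A' ≠ {⊥} := by
      rintro rfl
      obtain ⟨c, hc, hcb⟩ := hle ⟨⊥, rfl, le_rfl⟩
      exact hB1 (hA''.eq_singleton_bot (le_bot_iff.1 hcb ▸ hc))
    rw [yr, if_neg hB0, if_neg hB1, yr, if_neg hA0, if_neg hA1]
    exact filt_minOf_mono
      (relBlock_subset_of_filt_subset ω hr0 hA'' hA0 hA1 hB0 hB1 hle)
end

section
/- Let ω be a weight map and j an integer with 0 ≤ j < ω(P). For every antichain B in the image b_j(𝔄_▽(P)) of the absolute j-blocker map, the preimage (b_j)^{-1}(B) = {A an antichain in P : b_j(A) = B} is a convex subposet of 𝔄_▽(P) (if A ≤ C ≤ A' in 𝔄_▽(P) with A, A' ∈ (b_j)^{-1}(B), then C ∈ (b_j)^{-1}(B)), it is closed under the join of 𝔄_▽(P) (where A' ∨_▽ A'' := min(A' ∪ A'')), and its greatest element is b_j(B). -/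
open scoped Classical

variable {α : Type*}

/-- The absolute `j`-blocker map `b_j` on antichains: a nontrivial antichain `A` is sent to
`min {b ∈ P : ω({b} ∧_▵ {a}) > j for all a ∈ A}`, and `∅ ↦ {⊥}`, `{⊥} ↦ ∅`. -/
noncomputable def bj [PartialOrder α] [OrderBot α] (ω : WeightMap α) (j : ℤ)
    (A : Set α) : Set α :=
  if A = ∅ then ({⊥} : Set α)
  else if A = ({⊥} : Set α) then ∅
  else minOf {b | ∀ a ∈ A, j < ω.w (meetT {b} {a})}

theorem maxOf_singleton [PartialOrder α] (a : α) : maxOf ({a} : Set α) = {a} := by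
  ext x
  constructor
  · exact fun hx => hx.1
  · rintro rfl
    exact ⟨rfl, fun y hy _ => hy.symm⟩

theorem isAntichain_minOf [PartialOrder α] (S : Set α) : IsAntichain (· ≤ ·) (minOf S) :=
  fun _ hx _ hy hne hle => hne (hy.2 _ hx.1 hle).symm

theorem idl_maxOf [Finite α] [PartialOrder α] {S : Set α} (hS : IsLowerSet S) :
    idl (maxOf S) = S := by
  ext x
  constructor
  · rintro ⟨s, hs, hxs⟩
    exact hS hxs hs.1
  · intro hx
    obtain ⟨m, hxm, hm⟩ := S.toFinite.exists_le_maximal hx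
    exact ⟨m, ⟨hm.prop, fun y hy hmy => le_antisymm hmy (hm.le_of_ge hy hmy)⟩, hxm⟩

theorem subset_filt_minOf [Finite α] [PartialOrder α] (S : Set α) : S ⊆ filt (minOf S) := by
  intro x hx
  obtain ⟨m, hmx, hm⟩ := S.toFinite.exists_le_minimal hx
  exact ⟨m, ⟨hm.prop, fun y hy hym => le_antisymm (hm.le_of_le hy hym) hym⟩, hmx⟩

theorem subset_filt [PartialOrder α] (S : Set α) : S ⊆ filt S := fun x hx => ⟨x, hx, le_rfl⟩

theorem filt_minOf [Finite α] [PartialOrder α] {S : Set α} (hS : IsUpperSet S) :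
    filt (minOf S) = S := by
  refine Set.Subset.antisymm ?_ (subset_filt_minOf S)
  rintro x ⟨s, hs, hsx⟩
  exact hS hsx hs.1

theorem minOf_filt [PartialOrder α] {A : Set α} (hA : IsAntichain (· ≤ ·) A) :
    minOf (filt A) = A := by
  ext x
  constructor
  · rintro ⟨⟨s, hs, hsx⟩, hmin⟩
    rwa [hmin s (subset_filt A hs) hsx]
  · intro hx
    refine ⟨subset_filt A hx, ?_⟩
    rintro y ⟨s, hs, hsy⟩ hyx
    obtain rfl := hA.eq hs hx (hsy.trans hyx)
    exact le_antisymm hsy hyx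

theorem meetT_comm [PartialOrder α] (A B : Set α) : meetT A B = meetT B A := by
  rw [meetT, meetT, Set.inter_comm]

theorem idl_singleton [PartialOrder α] (a : α) : idl ({a} : Set α) = Set.Iic a := by
  ext
  simp [idl]

theorem idl_meetT_singleton [Finite α] [PartialOrder α] (a b : α) :
    idl (meetT {a} {b}) = Set.Iic a ∩ Set.Iic b := by
  rw [meetT, idl_singleton, idl_singleton]
  exact idl_maxOf ((isLowerSet_Iic a).inter (isLowerSet_Iic b))

theorem lt_w_meetT_mono [Finite α] [PartialOrder α] [OrderBot α] (ω : WeightMap α) {j : ℤ}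
    (hj : 0 ≤ j) {a b c d : α} (hac : a ≤ c) (hbd : b ≤ d) (h : j < ω.w (meetT {a} {b})) :
    j < ω.w (meetT {c} {d}) := by
  refine h.trans_le (ω.w_pos_mono (meetT {a} {b}) (meetT {c} {d}) (isAntichain_maxOf _)
    (isAntichain_maxOf _) ?_ ?_).2
  · rw [idl_meetT_singleton, idl_singleton, Set.Iic_bot]
    refine Set.ssubset_iff_subset_ne.2 ⟨by simp, fun heq => ?_⟩
    have hbot : meetT {a} {b} = ({⊥} : Set α) := by
      rw [meetT, idl_singleton, idl_singleton, ← heq, maxOf_singleton]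
    rw [hbot, ω.w_bot] at h
    exact hj.not_gt h
  · rw [idl_meetT_singleton, idl_meetT_singleton]
    exact Set.inter_subset_inter (Set.Iic_subset_Iic.2 hac) (Set.Iic_subset_Iic.2 hbd)

/-- The elements that `j`-block every element of `A`. -/
def blockers [PartialOrder α] [OrderBot α] (ω : WeightMap α) (j : ℤ) (A : Set α) : Set α :=
  {b | ∀ a ∈ A, j < ω.w (meetT {b} {a})}

section blockers

variable [PartialOrder α] [OrderBot α] (ω : WeightMap α) (j : ℤ)

theorem blockers_anti {A B : Set α} (h : A ⊆ B) : blockers ω j B ⊆ blockers ω j A :=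
  fun _ hb a ha => hb a (h ha)

theorem blockers_union (A B : Set α) :
    blockers ω j (A ∪ B) = blockers ω j A ∩ blockers ω j B := by
  ext
  simp only [blockers, Set.mem_union, or_imp, forall_and, Set.mem_inter_iff, Set.mem_ofPred_eq]

theorem subset_blockers_blockers (A : Set α) : A ⊆ blockers ω j (blockers ω j A) := by
  intro a ha b hb
  rw [meetT_comm]
  exact hb a ha

theorem blockers_blockers_blockers (A : Set α) :
    blockers ω j (blockers ω j (blockers ω j A)) = blockers ω j A :=
  Set.Subset.antisymm (blockers_anti ω j (subset_blockers_blockers ω j A))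
    (subset_blockers_blockers ω j _)

variable {j : ℤ}

theorem bj_eq_minOf_blockers (hj : 0 ≤ j) (A : Set α) : bj ω j A = minOf (blockers ω j A) := by
  unfold bj
  split_ifs with h₀ h₁
  · subst h₀
    ext x
    constructor
    · rintro rfl
      exact ⟨fun a ha => ha.elim, fun y _ hy => (le_bot_iff.1 hy).symm⟩
    · exact fun hx => hx.2 ⊥ (fun a ha => ha.elim) bot_le
  · subst h₁
    symm
    rw [Set.eq_empty_iff_forall_notMem]
    intro x hx
    have h := hx.1 ⊥ rfl
    have hbot : meetT {x} {⊥} = ({⊥} : Set α) := by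
      rw [meetT, idl_singleton, idl_singleton, Set.Iic_bot,
        Set.inter_eq_right.2 (Set.singleton_subset_iff.2 (Set.mem_Iic.2 bot_le)),
        maxOf_singleton]
    rw [hbot, ω.w_bot] at h
    exact hj.not_gt h
  · rfl

theorem isAntichain_bj (hj : 0 ≤ j) (A : Set α) : IsAntichain (· ≤ ·) (bj ω j A) := by
  rw [bj_eq_minOf_blockers ω hj]
  exact isAntichain_minOf _

variable [Finite α]

theorem isUpperSet_blockers (hj : 0 ≤ j) (A : Set α) : IsUpperSet (blockers ω j A) :=
  fun _ _ hbc hb a ha => lt_w_meetT_mono ω hj hbc le_rfl (hb a ha)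

theorem blockers_filt (hj : 0 ≤ j) (A : Set α) : blockers ω j (filt A) = blockers ω j A := by
  refine Set.Subset.antisymm (blockers_anti ω j (subset_filt A)) ?_
  rintro b hb p ⟨a, ha, hap⟩
  exact lt_w_meetT_mono ω hj le_rfl hap (hb a ha)

theorem blockers_minOf (hj : 0 ≤ j) (A : Set α) : blockers ω j (minOf A) = blockers ω j A := by
  refine Set.Subset.antisymm ?_ (blockers_anti ω j fun _ hx => hx.1)
  rw [← blockers_filt ω hj (minOf A)]
  exact blockers_anti ω j (subset_filt_minOf A)

theorem filt_bj (hj : 0 ≤ j) (A : Set α) : filt (bj ω j A) = blockers ω j A := by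
  rw [bj_eq_minOf_blockers ω hj, filt_minOf (isUpperSet_blockers ω hj A)]

theorem bj_eq_iff (hj : 0 ≤ j) {A B : Set α} (hB : IsAntichain (· ≤ ·) B) :
    bj ω j A = B ↔ blockers ω j A = filt B := by
  constructor
  · rintro rfl
    exact (filt_bj ω hj A).symm
  · intro h
    rw [bj_eq_minOf_blockers ω hj, h, minOf_filt hB]

theorem blockers_bj (hj : 0 ≤ j) (A : Set α) :
    blockers ω j (bj ω j A) = blockers ω j (blockers ω j A) := by
  rw [bj_eq_minOf_blockers ω hj, blockers_minOf ω hj]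

end blockers

/-- For any `B` in the image of `b_j`, the preimage `(b_j)⁻¹(B)` (within antichains)
is a convex subposet of `𝔄_▽(P)`, is closed under the join
`A' ∨_▽ A'' = min(A' ∪ A'')`, and has `b_j(B)` as its greatest element. -/
theorem stmt_7 [Fintype α] [PartialOrder α] [BoundedOrder α] [Nontrivial α]
    (ω : WeightMap α) (j : ℤ) (hj0 : 0 ≤ j) (hj : j < ω.w ({⊤} : Set α))
    (B : Set α) (hB : B ∈ bj ω j '' {A : Set α | IsAntichain (· ≤ ·) A})
    (Pre : Set (Set α)) (hPre : Pre = {A : Set α | IsAntichain (· ≤ ·) A ∧ bj ω j A = B}) :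
    (∀ A ∈ Pre, ∀ A' ∈ Pre, ∀ C : Set α, IsAntichain (· ≤ ·) C →
        filt A ⊆ filt C → filt C ⊆ filt A' → C ∈ Pre) ∧
    (∀ A ∈ Pre, ∀ A' ∈ Pre, minOf (A ∪ A') ∈ Pre) ∧
    (bj ω j B ∈ Pre ∧ ∀ A ∈ Pre, filt A ⊆ filt (bj ω j B)) := by
  obtain ⟨A₀, -, rfl⟩ := hB
  subst hPre
  simp only [Set.mem_ofPred_eq, bj_eq_iff ω hj0 (isAntichain_bj ω hj0 A₀)]
  rw [filt_bj ω hj0]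
  refine ⟨?_, ?_, ⟨isAntichain_bj ω hj0 _, ?_⟩, ?_⟩
  · rintro A ⟨-, hA⟩ A' ⟨-, hA'⟩ C hC hAC hCA'
    refine ⟨hC, Set.Subset.antisymm ?_ ?_⟩
    · rw [← hA, ← blockers_filt ω hj0 A, ← blockers_filt ω hj0 C]
      exact blockers_anti ω j hAC
    · rw [← hA', ← blockers_filt ω hj0 A', ← blockers_filt ω hj0 C]
      exact blockers_anti ω j hCA'
  · rintro A ⟨-, hA⟩ A' ⟨-, hA'⟩
    refine ⟨isAntichain_minOf _, ?_⟩
    rw [blockers_minOf ω hj0, blockers_union, hA, hA', Set.inter_self]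
  · rw [blockers_bj ω hj0, blockers_bj ω hj0, blockers_blockers_blockers]
  · rintro A ⟨-, hA⟩
    rw [filt_bj ω hj0, blockers_bj ω hj0, ← hA, ← blockers_filt ω hj0 A]
    exact subset_blockers_blockers ω j _
end
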